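/- For every sequent Γ: Γ is provable in PLL if and only if Γ is provable in wpPLL∞, the set of weakly progressing coderivations of PLL∞. -/

import Mathlib

namespace NWPLL

/-! ## Formulas and sequents -/

inductive Formula : Type where
  | var : ℕ → Formula
  | covar : ℕ → Formula
  | tens : Formula → Formula → Formula
  | parr : Formula → Formula → Formula
  | bang : Formula → Formula
  | quest : Formula → Formula
  | one : Formula
  | bot : Formula
deriving DecidableEq

/-- Linear negation, defined by De Morgan duality. -/
def Formula.neg : Formula → Formula
  | .var n => .covar n
  | .covar n => .var n
  | .tens A B => .parr A.neg B.neg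
  | .parr A B => .tens A.neg B.neg
  | .bang A => .quest A.neg
  | .quest A => .bang A.neg
  | .one => .bot
  | .bot => .one

/-- A sequent is a finite list of formula occurrences. -/
abbrev Sequent := List Formula

/-! ## Rules -/

inductive RuleName : Type where
  | ax | cut | tens | parr | one | bot | qw | qb | cp | fp | hyp | dig
deriving DecidableEq

/-- Canonical instances of the rules (principal formulas at the head,
conclusion of a rule together with the list of its premises, in order). -/
inductive Canon : RuleName → Sequent → List Sequent → Prop where
  | ax (A : Formula) : Canon .ax [A, A.neg] []
  | cut (A : Formula) (Γ Δ : Sequent) : Canon .cut (Γ ++ Δ) [A :: Γ, A.neg :: Δ]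
  | tens (A B : Formula) (Γ Δ : Sequent) :
      Canon .tens (A.tens B :: (Γ ++ Δ)) [A :: Γ, B :: Δ]
  | parr (A B : Formula) (Γ : Sequent) : Canon .parr (A.parr B :: Γ) [A :: B :: Γ]
  | one : Canon .one [.one] []
  | bot (Γ : Sequent) : Canon .bot (.bot :: Γ) [Γ]
  | qw (A : Formula) (Γ : Sequent) : Canon .qw (A.quest :: Γ) [Γ]
  | qb (A : Formula) (Γ : Sequent) : Canon .qb (A.quest :: Γ) [A :: A.quest :: Γ]
  | cp (A : Formula) (Γ : Sequent) :
      Canon .cp (A.bang :: Γ.map .quest) [A :: Γ, A.bang :: Γ.map .quest]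
  | fp (A : Formula) (Γ : Sequent) : Canon .fp (A.bang :: Γ.map .quest) [A :: Γ]
  | hyp (Γ : Sequent) : Canon .hyp Γ []
  | dig (A : Formula) (Γ : Sequent) : Canon .dig (A.quest :: Γ) [A.quest.quest :: Γ]

/-- A rule instance: a canonical instance up to permutation of each sequent
(sequents are lists of occurrences, managed up to exchange). -/
def RuleOk (r : RuleName) (C : Sequent) (ps : List Sequent) : Prop :=
  ∃ C₀ ps₀, Canon r C₀ ps₀ ∧ C.Perm C₀ ∧ List.Forall₂ List.Perm ps ps₀

/-! ## Coderivations -/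

/-- Nodes of a binary tree: `false` = first (left) child, `true` = second (right) child. -/
abbrev Node := List Bool

/-- A (possibly non-wellfounded) coderivation skeleton: a labelling of an
ordered-prefix-closed binary tree by pairs (rule name, sequent). -/
structure Coderivation : Type where
  label : Node → Option (RuleName × Sequent)
  root_isSome : (label []).isSome
  prefix_closed : ∀ v b, (label (v ++ [b])).isSome → (label v).isSome
  ordered : ∀ v, (label (v ++ [true])).isSome → (label (v ++ [false])).isSome

namespace Coderivation

def mem (D : Coderivation) (v : Node) : Prop := (D.label v).isSome

def ruleAt (D : Coderivation) (v : Node) : Option RuleName := (D.label v).map Prod.fst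

def seqAt (D : Coderivation) (v : Node) : Option Sequent := (D.label v).map Prod.snd

def conclusion (D : Coderivation) : Sequent := ((D.label []).map Prod.snd).getD []

/-- The list of premises (sequents of the children) of the rule at node `v`. -/
def premsAt (D : Coderivation) (v : Node) : List Sequent :=
  (D.seqAt (v ++ [false])).toList ++ (D.seqAt (v ++ [true])).toList

/-- `D` is a coderivation over the set of rules `S`: each node is a valid
instance of a rule of `S`. -/
def IsOver (D : Coderivation) (S : Set RuleName) : Prop :=
  ∀ v r Γ, D.label v = some (r, Γ) → r ∈ S ∧ RuleOk r Γ (D.premsAt v)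

def IsFinite (D : Coderivation) : Prop := {v : Node | D.mem v}.Finite

end Coderivation

/-! ## Systems -/

def pllRules : Set RuleName := {.ax, .cut, .tens, .parr, .one, .bot, .qw, .qb, .fp}
def pllInfRules : Set RuleName := {.ax, .cut, .tens, .parr, .one, .bot, .qw, .qb, .cp}
def oPllInfRules : Set RuleName := insert .hyp pllInfRules
def mellInfRules : Set RuleName := insert .dig pllInfRules

/-- Coderivations of `PLL∞`. -/
def PLLinf (D : Coderivation) : Prop := D.IsOver pllInfRules
/-- Open coderivations (`oPLL∞`). -/
def OPLLinf (D : Coderivation) : Prop := D.IsOver oPllInfRules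
/-- Coderivations of `MELL∞` (with digging). -/
def MELLinf (D : Coderivation) : Prop := D.IsOver mellInfRules
/-- Finite derivations of the sequent calculus `PLL` (with functorial promotion). -/
def IsPLLDer (D : Coderivation) : Prop := D.IsOver pllRules ∧ D.IsFinite

/-! ## Branches and global conditions -/

/-- The node at depth `n` along the infinite branch determined by the
direction function `β`. -/
def brNode (β : ℕ → Bool) (n : ℕ) : Node := (List.range n).map β

def InfBranch (D : Coderivation) (β : ℕ → Bool) : Prop := ∀ n, D.mem (brNode β n)

/-- Weak progressing: every infinite branch goes through the right premise of
a `c!p` rule infinitely often. -/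
def WeaklyProg (D : Coderivation) : Prop :=
  ∀ β, InfBranch D β →
    ∀ N, ∃ n, N ≤ n ∧ β n = true ∧ D.ruleAt (brNode β n) = some .cp

/-- Position of the parent (in canonical instances): `childParent r k b p` is
the position in the conclusion of which the formula at position `p` of premise
`b` is the parent; `k` is the length of the first premise. -/
def childParent : RuleName → ℕ → Bool → ℕ → Option ℕ
  | .cut, _, false, p => if p = 0 then none else some (p - 1)
  | .cut, k, true, p => if p = 0 then none else some (k - 1 + (p - 1))
  | .tens, _, false, p => if p = 0 then some 0 else some p
  | .tens, k, true, p => if p = 0 then some 0 else some (k + (p - 1))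
  | .parr, _, false, p => if p ≤ 1 then some 0 else some (p - 1)
  | .bot, _, false, p => some (p + 1)
  | .qw, _, false, p => some (p + 1)
  | .qb, _, false, p => if p = 0 then none else some (p - 1)
  | .cp, _, false, _ => none
  | .cp, _, true, p => some p
  | .fp, _, false, p => some p
  | .dig, _, false, p => some p
  | _, _, _, _ => none

/-- A position-preserving alignment between a sequent and (a permutation of
it given by) a canonical sequent. -/
def PosAlign (l l' : List Formula) (f : ℕ → ℕ) : Prop :=
  l.length = l'.length ∧
  (∀ i, i < l.length → f i < l'.length ∧ l'[f i]? = l[i]?) ∧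
  (∀ i j, i < l.length → j < l.length → f i = f j → i = j)

def bIdx : Bool → ℕ
  | false => 0
  | true => 1

/-- The formula occurrence at position `p` of the premise `b` of the rule at
node `v` is the parent of the occurrence at position `q` of its conclusion. -/
def IsParent (D : Coderivation) (v : Node) (b : Bool) (p q : ℕ) : Prop :=
  ∃ r C P C₀ P₀ ps₀, ∃ f g : ℕ → ℕ,
    D.label v = some (r, C) ∧ D.seqAt (v ++ [b]) = some P ∧
    Canon r C₀ ps₀ ∧ PosAlign C C₀ f ∧ ps₀[bIdx b]? = some P₀ ∧ PosAlign P P₀ g ∧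
    childParent r (ps₀.headD []).length b (g p) = some (f q)

/-- The occurrence at position `q` of the conclusion of the rule at `v` is the
principal `!`-formula of a `c!p` rule. -/
def PrincipalCp (D : Coderivation) (v : Node) (q : ℕ) : Prop :=
  ∃ C C₀ ps₀ f, D.label v = some (.cp, C) ∧ Canon .cp C₀ ps₀ ∧ PosAlign C C₀ f ∧ f q = 0

def Coderivation.formulaAt (D : Coderivation) (v : Node) (q : ℕ) : Option Formula :=
  (D.seqAt v).bind fun Γ => Γ[q]?

/-- The infinite branch `β` carries a progressing `!`-thread: from some point
on, a sequence of parent-linked `!`-formula occurrences which is infinitely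
often principal for a `c!p` rule. -/
def ProgThread (D : Coderivation) (β : ℕ → Bool) : Prop :=
  ∃ k, ∃ t : ℕ → ℕ,
    (∀ i, k ≤ i → ∃ A, D.formulaAt (brNode β i) (t i) = some (Formula.bang A)) ∧
    (∀ i, k ≤ i → IsParent D (brNode β i) (β i) (t (i + 1)) (t i)) ∧
    (∀ N, ∃ i, N ≤ i ∧ k ≤ i ∧ PrincipalCp D (brNode β i) (t i))

/-- Progressing criterion: every infinite branch carries a progressing `!`-thread. -/
def Progressing (D : Coderivation) : Prop := ∀ β, InfBranch D β → ProgThread D β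

/-! ## Basic constructors on coderivations -/

def node0 (r : RuleName) (Γ : Sequent) : Coderivation where
  label w := match w with
    | [] => some (r, Γ)
    | _ :: _ => none
  root_isSome := rfl
  prefix_closed := by
    intro v b h
    match v with
    | [] => exact rfl
    | c :: v' => exact Bool.noConfusion h
  ordered := by
    intro v h
    match v with
    | [] => exact Bool.noConfusion h
    | c :: v' => exact Bool.noConfusion h

def node1 (r : RuleName) (Γ : Sequent) (D : Coderivation) : Coderivation where
  label w := match w with
    | [] => some (r, Γ)
    | false :: w' => D.label w'
    | true :: _ => none
  root_isSome := rfl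
  prefix_closed := by
    intro v b h
    match v with
    | [] => exact rfl
    | false :: v' => exact D.prefix_closed v' b h
    | true :: v' => exact Bool.noConfusion h
  ordered := by
    intro v h
    match v with
    | [] => exact Bool.noConfusion h
    | false :: v' => exact D.ordered v' h
    | true :: v' => exact Bool.noConfusion h

def node2 (r : RuleName) (Γ : Sequent) (D E : Coderivation) : Coderivation where
  label w := match w with
    | [] => some (r, Γ)
    | false :: w' => D.label w'
    | true :: w' => E.label w'
  root_isSome := rfl
  prefix_closed := by
    intro v b h
    match v with
    | [] => exact rfl
    | false :: v' => exact D.prefix_closed v' b h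
    | true :: v' => exact E.prefix_closed v' b h
  ordered := by
    intro v h
    match v with
    | [] => exact D.root_isSome
    | false :: v' => exact D.ordered v' h
    | true :: v' => exact E.ordered v' h

/-- The single-node `hyp` open derivation with conclusion `Γ`. -/
def hypC (Γ : Sequent) : Coderivation := node0 .hyp Γ

/-- The sub-coderivation of `D` rooted at `v` (a default if `v` is not a node of `D`). -/
def Coderivation.subAt (D : Coderivation) (v : Node) : Coderivation :=
  if h : (D.label v).isSome then
    { label := fun w => D.label (v ++ w)
      root_isSome := by simpa using h
      prefix_closed := by
        intro u b hu
        have hu' : (D.label ((v ++ u) ++ [b])).isSome := by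
          rw [List.append_assoc]; exact hu
        exact D.prefix_closed (v ++ u) b hu'
      ordered := by
        intro u hu
        have hu' : (D.label ((v ++ u) ++ [true])).isSome := by
          rw [List.append_assoc]; exact hu
        have h2 := D.ordered (v ++ u) hu'
        show (D.label (v ++ (u ++ [false]))).isSome
        rw [← List.append_assoc]
        exact h2 }
  else node0 .hyp []

/-! ## Non-wellfounded boxes -/

/-- Splits a node into its number of leading `true`s and, if any, the rest of
the address after the first `false`. -/
def leadSplit : Node → ℕ × Option Node
  | [] => (0, none)
  | true :: w => ((leadSplit w).1 + 1, (leadSplit w).2)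
  | false :: w => (0, some w)

lemma leadSplit_append_none (w : Node) (h : (leadSplit w).2 = none) :
    leadSplit (w ++ [true]) = ((leadSplit w).1 + 1, none) ∧
    leadSplit (w ++ [false]) = ((leadSplit w).1, some []) := by
  induction w with
  | nil => exact ⟨rfl, rfl⟩
  | cons c w ih =>
    cases c with
    | false => exact absurd h (by simp [leadSplit])
    | true =>
      have h' : (leadSplit w).2 = none := by simpa [leadSplit] using h
      obtain ⟨h1, h2⟩ := ih h'
      constructor
      · show leadSplit (true :: (w ++ [true])) = _
        simp [leadSplit, h1]
      · show leadSplit (true :: (w ++ [false])) = _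
        simp [leadSplit, h2]

lemma leadSplit_append_some (w u : Node) (h : (leadSplit w).2 = some u) (b : Bool) :
    leadSplit (w ++ [b]) = ((leadSplit w).1, some (u ++ [b])) := by
  induction w with
  | nil => simp [leadSplit] at h
  | cons c w ih =>
    cases c with
    | false =>
      have hw : w = u := by simpa [leadSplit] using h
      subst hw
      simp [leadSplit]
    | true =>
      have h' : (leadSplit w).2 = some u := by simpa [leadSplit] using h
      have := ih h'
      show leadSplit (true :: (w ++ [b])) = _
      simp [leadSplit, this]

/-- The non-wellfounded box with conclusion `Γ`, whose `i`-th call is `g i`: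
its main branch `{ε, 2, 22, …}` consists of `c!p` rules. -/
def nwbOf (Γ : Sequent) (g : ℕ → Coderivation) : Coderivation where
  label w := match (leadSplit w).2 with
    | none => some (.cp, Γ)
    | some u => (g (leadSplit w).1).label u
  root_isSome := rfl
  prefix_closed := by
    intro w b h
    have h' : (match (leadSplit (w ++ [b])).2 with
      | none => some (RuleName.cp, Γ)
      | some u => (g (leadSplit (w ++ [b])).1).label u).isSome := h
    show (match (leadSplit w).2 with
      | none => some (RuleName.cp, Γ)
      | some u => (g (leadSplit w).1).label u).isSome
    rcases hw : (leadSplit w).2 with _ | u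
    · rfl
    · have ha := leadSplit_append_some w u hw b
      rw [ha] at h'
      exact (g (leadSplit w).1).prefix_closed u b h'
  ordered := by
    intro w h
    have h' : (match (leadSplit (w ++ [true])).2 with
      | none => some (RuleName.cp, Γ)
      | some u => (g (leadSplit (w ++ [true])).1).label u).isSome := h
    show (match (leadSplit (w ++ [false])).2 with
      | none => some (RuleName.cp, Γ)
      | some u => (g (leadSplit (w ++ [false])).1).label u).isSome
    rcases hw : (leadSplit w).2 with _ | u
    · have haf := (leadSplit_append_none w hw).2
      rw [haf]
      exact (g (leadSplit w).1).root_isSome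
    · have hat := leadSplit_append_some w u hw true
      have haf := leadSplit_append_some w u hw false
      rw [hat] at h'
      rw [haf]
      exact (g (leadSplit w).1).ordered u h'

/-- The node `v` of `D` is the root of a non-wellfounded box. -/
def IsNwbAt (D : Coderivation) (v : Node) : Prop :=
  ∀ n : ℕ, D.ruleAt (v ++ List.replicate n true) = some .cp

/-- Every `c!p` rule of `D` belongs to the main branch of a non-wellfounded box. -/
def CpInNwb (D : Coderivation) : Prop :=
  ∀ v, D.ruleAt v = some .cp →
    ∃ w k, v = w ++ List.replicate k true ∧ IsNwbAt D w

/-! ## Regularity and finite expandability -/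

def Regular (D : Coderivation) : Prop :=
  {E : Coderivation | ∃ v, D.mem v ∧ E = D.subAt v}.Finite

def WeaklyRegular (D : Coderivation) : Prop :=
  {E : Coderivation | ∃ v, D.ruleAt v = some .cp ∧ E = D.subAt (v ++ [false])}.Finite

def FinExp (D : Coderivation) : Prop :=
  ∀ β, InfBranch D β →
    {n : ℕ | D.ruleAt (brNode β n) = some .cut ∨ D.ruleAt (brNode β n) = some .qb}.Finite

/-- `rPLL∞`: regular, finitely expandable, progressing coderivations of `PLL∞`. -/
def rPLL (D : Coderivation) : Prop := PLLinf D ∧ Progressing D ∧ FinExp D ∧ Regular D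

/-- `wrPLL∞`: weakly regular, finitely expandable, progressing coderivations of `PLL∞`. -/
def wrPLL (D : Coderivation) : Prop := PLLinf D ∧ Progressing D ∧ FinExp D ∧ WeaklyRegular D

def CutFree (D : Coderivation) : Prop := ∀ v, D.ruleAt v ≠ some .cut

/-- No cut-elimination step applies: one premise of each cut is a `hyp`. -/
def Normal (D : Coderivation) : Prop :=
  ∀ v, D.ruleAt v = some .cut →
    D.ruleAt (v ++ [false]) = some .hyp ∨ D.ruleAt (v ++ [true]) = some .hyp

/-! ## Pruning and approximations -/

lemma prefix_snoc_cases {u v : Node} {x : Bool} (h : u <+: v ++ [x]) :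
    u <+: v ∨ u = v ++ [x] := by
  rcases Nat.lt_or_ge u.length (v ++ [x]).length with hl | hl
  · left
    have hle : u.length ≤ v.length := by
      have := hl
      simp only [List.length_append, List.length_cons, List.length_nil] at this
      omega
    exact List.prefix_of_prefix_length_le h (List.prefix_append v [x]) hle
  · right
    exact h.eq_of_length (le_antisymm h.length_le (le_trans hl (le_of_eq rfl)))

open Classical in
noncomputable def pruneLabel (D : Coderivation) (V : Set Node) (w : Node) :
    Option (RuleName × Sequent) :=
  if ∃ v ∈ V, v <+: w ∧ v ≠ w then none
  else if w ∈ V then (D.label w).map fun p => (.hyp, p.2)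
  else D.label w

lemma pruneLabel_isSome {D : Coderivation} {V : Set Node} {w : Node}
    (h : (pruneLabel D V w).isSome) :
    (D.label w).isSome ∧ ¬ ∃ v ∈ V, v <+: w ∧ v ≠ w := by
  classical
  unfold pruneLabel at h
  split_ifs at h with h1 h2
  · exact absurd h (by simp)
  · exact ⟨by simpa using h, h1⟩
  · exact ⟨h, h1⟩

-- Pruning: replace the sub-coderivations of `D` rooted at the nodes of `V` by `hyp`.
open Classical in
noncomputable def prune (D : Coderivation) (V : Set Node) : Coderivation where
  label := pruneLabel D V
  root_isSome := by
    classical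
    unfold pruneLabel
    split_ifs with h1 h2
    · exfalso
      obtain ⟨v, _, hpre, hne⟩ := h1
      exact hne (List.prefix_nil.mp hpre)
    · simpa using D.root_isSome
    · exact D.root_isSome
  prefix_closed := by
    classical
    intro v b h
    obtain ⟨hD, hno⟩ := pruneLabel_isSome h
    have hDv : (D.label v).isSome := D.prefix_closed v b hD
    have hnov : ¬ ∃ u ∈ V, u <+: v ∧ u ≠ v := by
      rintro ⟨u, hu, hpre, hne⟩
      refine hno ⟨u, hu, hpre.trans (List.prefix_append _ _), fun he => ?_⟩
      have hlen := congrArg List.length he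
      have hle : u.length ≤ v.length := hpre.length_le
      simp only [List.length_append, List.length_cons, List.length_nil] at hlen
      omega
    have hvnotV : v ∉ V := by
      intro hv
      refine hno ⟨v, hv, List.prefix_append _ _, fun he => ?_⟩
      have hlen := congrArg List.length he
      simp only [List.length_append, List.length_cons, List.length_nil] at hlen
      omega
    show (pruneLabel D V v).isSome
    unfold pruneLabel
    rw [if_neg hnov, if_neg hvnotV]
    exact hDv
  ordered := by
    classical
    intro v h
    obtain ⟨hDt, hno⟩ := pruneLabel_isSome h
    have hDf : (D.label (v ++ [false])).isSome := D.ordered v hDt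
    have hno' : ¬ ∃ u ∈ V, u <+: v ++ [false] ∧ u ≠ v ++ [false] := by
      rintro ⟨u, hu, hpre, hne⟩
      rcases prefix_snoc_cases hpre with hu_v | heq
      · rcases eq_or_ne u v with rfl | hne'
        · refine hno ⟨u, hu, List.prefix_append _ _, fun he => ?_⟩
          have hlen := congrArg List.length he
          simp only [List.length_append, List.length_cons, List.length_nil] at hlen
          omega
        · refine hno ⟨u, hu, hu_v.trans (List.prefix_append _ _), fun he => ?_⟩
          have hlen := congrArg List.length he
          have hle : u.length ≤ v.length := hu_v.length_le
          simp only [List.length_append, List.length_cons, List.length_nil] at hlen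
          omega
      · exact hne heq
    show (pruneLabel D V (v ++ [false])).isSome
    unfold pruneLabel
    rw [if_neg hno']
    by_cases hmem : v ++ [false] ∈ V
    · rw [if_pos hmem]
      simpa using hDf
    · rw [if_neg hmem]
      exact hDf

/-- `E` approximates `D`: `E` is obtained from `D` by pruning at a set of
pairwise incomparable nodes. -/
def Approx (E D : Coderivation) : Prop :=
  ∃ V : Set Node, (∀ v ∈ V, ∀ w ∈ V, v <+: w → v = w) ∧ E = prune D V

/-- The greatest cut-free approximation of `D`: prune at the minimal cut nodes. -/
noncomputable def cf (D : Coderivation) : Coderivation :=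
  prune D {v | D.ruleAt v = some .cut ∧
    ∀ w, w <+: v → w ≠ v → D.ruleAt w ≠ some .cut}

/-! ## Suprema of countable families of open coderivations -/

open Classical in
noncomputable def chainSupLabel (s : ℕ → Coderivation) (w : Node) :
    Option (RuleName × Sequent) :=
  if h : ∃ i, ((s i).label w).isSome ∧ (s i).ruleAt w ≠ some .hyp then (s h.choose).label w
  else if h2 : ∃ i, ((s i).label w).isSome then (s h2.choose).label w
  else none

lemma chainSupLabel_isSome (s : ℕ → Coderivation) (w : Node) :
    (chainSupLabel s w).isSome ↔ ∃ i, ((s i).label w).isSome := by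
  classical
  unfold chainSupLabel
  split_ifs with h1 h2
  · exact ⟨fun _ => ⟨h1.choose, h1.choose_spec.1⟩, fun _ => h1.choose_spec.1⟩
  · exact ⟨fun _ => h2, fun _ => h2.choose_spec⟩
  · simp [h2]

/-- The supremum of a countable (increasing) family of open coderivations. -/
noncomputable def chainSup (s : ℕ → Coderivation) : Coderivation where
  label := chainSupLabel s
  root_isSome := (chainSupLabel_isSome s []).mpr ⟨0, (s 0).root_isSome⟩
  prefix_closed := by
    intro v b h
    obtain ⟨i, hi⟩ := (chainSupLabel_isSome s _).mp h
    exact (chainSupLabel_isSome s v).mpr ⟨i, (s i).prefix_closed v b hi⟩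
  ordered := by
    intro v h
    obtain ⟨i, hi⟩ := (chainSupLabel_isSome s _).mp h
    exact (chainSupLabel_isSome s _).mpr ⟨i, (s i).ordered v hi⟩

/-! ## Cut elimination steps -/

/-- Iterated weakenings introducing `?Γ` over `E` (of conclusion `Δ`). -/
def weakAll : List Formula → Sequent → Coderivation → Coderivation
  | [], _, E => E
  | A :: Γ, Δ, E => node1 .qw (A.quest :: (Γ.map .quest ++ Δ)) (weakAll Γ Δ E)

/-- Iterated absorptions absorbing the formulas of `Γ`; the root has conclusion `C`. -/
def absAll : List Formula → Sequent → Coderivation → Coderivation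
  | [], _, E => E
  | A :: Γ, C, E => node1 .qb C (absAll Γ (A :: C) E)

/-- Root cut-elimination steps (principal and commutative). -/
inductive StepRoot : Coderivation → Coderivation → Prop where
  | ax (A : Formula) (Δ : Sequent) (E : Coderivation)
      (hE : E.conclusion = A.neg :: Δ) :
      StepRoot (node2 .cut (A.neg :: Δ) (node0 .ax [A, A.neg]) E) E
  | tens_parr (A B : Formula) (Γ Δ Θ : Sequent) (D E₁ E₂ : Coderivation)
      (hD : D.conclusion = A :: B :: Γ)
      (hE₁ : E₁.conclusion = A.neg :: Δ) (hE₂ : E₂.conclusion = B.neg :: Θ) :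
      StepRoot
        (node2 .cut (Γ ++ (Δ ++ Θ))
          (node1 .parr (A.parr B :: Γ) D)
          (node2 .tens (A.neg.tens B.neg :: (Δ ++ Θ)) E₁ E₂))
        (node2 .cut (Γ ++ (Δ ++ Θ))
          (node2 .cut (B :: (Γ ++ Δ)) D E₁) E₂)
  | one_bot (Γ : Sequent) (D : Coderivation) (hD : D.conclusion = Γ) :
      StepRoot (node2 .cut Γ (node1 .bot (.bot :: Γ) D) (node0 .one [.one])) D
  | cp_cp (A B : Formula) (Γ Δ : Sequent) (D₁ D₂ E₁ E₂ : Coderivation)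
      (hD₁ : D₁.conclusion = A :: Γ)
      (hD₂ : D₂.conclusion = A.bang :: Γ.map .quest)
      (hE₁ : E₁.conclusion = B :: A.neg :: Δ)
      (hE₂ : E₂.conclusion = B.bang :: A.neg.quest :: Δ.map .quest) :
      StepRoot
        (node2 .cut (B.bang :: (Γ ++ Δ).map .quest)
          (node2 .cp (A.bang :: Γ.map .quest) D₁ D₂)
          (node2 .cp (B.bang :: A.neg.quest :: Δ.map .quest) E₁ E₂))
        (node2 .cp (B.bang :: (Γ ++ Δ).map .quest)
          (node2 .cut (B :: (Γ ++ Δ)) D₁ E₁)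
          (node2 .cut (B.bang :: (Γ ++ Δ).map .quest) D₂ E₂))
  | cp_qw (A : Formula) (Γ Δ : Sequent) (D₁ D₂ E : Coderivation)
      (hD₁ : D₁.conclusion = A :: Γ)
      (hD₂ : D₂.conclusion = A.bang :: Γ.map .quest)
      (hE : E.conclusion = Δ) :
      StepRoot
        (node2 .cut (Γ.map .quest ++ Δ)
          (node2 .cp (A.bang :: Γ.map .quest) D₁ D₂)
          (node1 .qw (A.neg.quest :: Δ) E))
        (weakAll Γ Δ E)
  | cp_qb (A : Formula) (Γ Δ : Sequent) (D₁ D₂ E : Coderivation)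
      (hD₁ : D₁.conclusion = A :: Γ)
      (hD₂ : D₂.conclusion = A.bang :: Γ.map .quest)
      (hE : E.conclusion = A.neg :: A.neg.quest :: Δ) :
      StepRoot
        (node2 .cut (Γ.map .quest ++ Δ)
          (node2 .cp (A.bang :: Γ.map .quest) D₁ D₂)
          (node1 .qb (A.neg.quest :: Δ) E))
        (absAll Γ (Γ.map .quest ++ Δ)
          (node2 .cut (Γ ++ (Γ.map .quest ++ Δ)) D₁
            (node2 .cut (A.neg :: (Γ.map .quest ++ Δ)) D₂ E)))
  | fp_fp (A B : Formula) (Γ Δ : Sequent) (D E : Coderivation)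
      (hD : D.conclusion = A :: Γ) (hE : E.conclusion = B :: A.neg :: Δ) :
      StepRoot
        (node2 .cut (B.bang :: (Γ ++ Δ).map .quest)
          (node1 .fp (A.bang :: Γ.map .quest) D)
          (node1 .fp (B.bang :: A.neg.quest :: Δ.map .quest) E))
        (node1 .fp (B.bang :: (Γ ++ Δ).map .quest)
          (node2 .cut (B :: (Γ ++ Δ)) D E))
  | fp_qw (A : Formula) (Γ Δ : Sequent) (D E : Coderivation)
      (hD : D.conclusion = A :: Γ) (hE : E.conclusion = Δ) :
      StepRoot
        (node2 .cut (Γ.map .quest ++ Δ)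
          (node1 .fp (A.bang :: Γ.map .quest) D)
          (node1 .qw (A.neg.quest :: Δ) E))
        (weakAll Γ Δ E)
  | fp_qb (A : Formula) (Γ Δ : Sequent) (D E : Coderivation)
      (hD : D.conclusion = A :: Γ) (hE : E.conclusion = A.neg :: A.neg.quest :: Δ) :
      StepRoot
        (node2 .cut (Γ.map .quest ++ Δ)
          (node1 .fp (A.bang :: Γ.map .quest) D)
          (node1 .qb (A.neg.quest :: Δ) E))
        (absAll Γ (Γ.map .quest ++ Δ)
          (node2 .cut (Γ ++ (Γ.map .quest ++ Δ)) D
            (node2 .cut (A.neg :: (Γ.map .quest ++ Δ))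
              (node1 .fp (A.bang :: Γ.map .quest) D) E)))
  | comm1 (r : RuleName) (A : Formula) (Γ Γ' Δ : Sequent) (D E : Coderivation)
      (hr : r ≠ .cut)
      (h1 : RuleOk r (A :: Γ) [A :: Γ'])
      (h2 : RuleOk r (Γ ++ Δ) [Γ' ++ Δ])
      (hD : D.conclusion = A :: Γ') (hE : E.conclusion = A.neg :: Δ) :
      StepRoot (node2 .cut (Γ ++ Δ) (node1 r (A :: Γ) D) E)
               (node1 r (Γ ++ Δ) (node2 .cut (Γ' ++ Δ) D E))
  | comm2a (r : RuleName) (A : Formula) (Γ Γ₁ Γ₂ Δ : Sequent) (D₁ D₂ E : Coderivation)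
      (hr : r ≠ .cut)
      (h1 : RuleOk r (A :: Γ) [A :: Γ₁, Γ₂])
      (h2 : RuleOk r (Γ ++ Δ) [Γ₁ ++ Δ, Γ₂])
      (hD₁ : D₁.conclusion = A :: Γ₁) (hE : E.conclusion = A.neg :: Δ) :
      StepRoot (node2 .cut (Γ ++ Δ) (node2 r (A :: Γ) D₁ D₂) E)
               (node2 r (Γ ++ Δ) (node2 .cut (Γ₁ ++ Δ) D₁ E) D₂)
  | comm2b (r : RuleName) (A : Formula) (Γ Γ₁ Γ₂ Δ : Sequent) (D₁ D₂ E : Coderivation)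
      (hr : r ≠ .cut)
      (h1 : RuleOk r (A :: Γ) [Γ₁, A :: Γ₂])
      (h2 : RuleOk r (Γ ++ Δ) [Γ₁, Γ₂ ++ Δ])
      (hD₂ : D₂.conclusion = A :: Γ₂) (hE : E.conclusion = A.neg :: Δ) :
      StepRoot (node2 .cut (Γ ++ Δ) (node2 r (A :: Γ) D₁ D₂) E)
               (node2 r (Γ ++ Δ) D₁ (node2 .cut (Γ₂ ++ Δ) D₂ E))
  | comm1r (r : RuleName) (A : Formula) (Γ Δ Δ' : Sequent) (D E : Coderivation)
      (hr : r ≠ .cut)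
      (h1 : RuleOk r (A.neg :: Δ) [A.neg :: Δ'])
      (h2 : RuleOk r (Γ ++ Δ) [Γ ++ Δ'])
      (hD : D.conclusion = A :: Γ) (hE : E.conclusion = A.neg :: Δ') :
      StepRoot (node2 .cut (Γ ++ Δ) D (node1 r (A.neg :: Δ) E))
               (node1 r (Γ ++ Δ) (node2 .cut (Γ ++ Δ') D E))
  | comm2ra (r : RuleName) (A : Formula) (Γ Δ Δ₁ Δ₂ : Sequent) (D E₁ E₂ : Coderivation)
      (hr : r ≠ .cut)
      (h1 : RuleOk r (A.neg :: Δ) [A.neg :: Δ₁, Δ₂])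
      (h2 : RuleOk r (Γ ++ Δ) [Γ ++ Δ₁, Δ₂])
      (hD : D.conclusion = A :: Γ) (hE₁ : E₁.conclusion = A.neg :: Δ₁) :
      StepRoot (node2 .cut (Γ ++ Δ) D (node2 r (A.neg :: Δ) E₁ E₂))
               (node2 r (Γ ++ Δ) (node2 .cut (Γ ++ Δ₁) D E₁) E₂)
  | comm2rb (r : RuleName) (A : Formula) (Γ Δ Δ₁ Δ₂ : Sequent) (D E₁ E₂ : Coderivation)
      (hr : r ≠ .cut)
      (h1 : RuleOk r (A.neg :: Δ) [Δ₁, A.neg :: Δ₂])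
      (h2 : RuleOk r (Γ ++ Δ) [Δ₁, Γ ++ Δ₂])
      (hD : D.conclusion = A :: Γ) (hE₂ : E₂.conclusion = A.neg :: Δ₂) :
      StepRoot (node2 .cut (Γ ++ Δ) D (node2 r (A.neg :: Δ) E₁ E₂))
               (node2 r (Γ ++ Δ) E₁ (node2 .cut (Γ ++ Δ₂) D E₂))

/-- A cut-elimination step performed at node `v`. -/
inductive StepAt : Node → Coderivation → Coderivation → Prop where
  | here {D E : Coderivation} : StepRoot D E → StepAt [] D E
  | in1 {v : Node} {D D' : Coderivation} (r : RuleName) (Γ : Sequent) :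
      StepAt v D D' → StepAt (false :: v) (node1 r Γ D) (node1 r Γ D')
  | in2l {v : Node} {D D' : Coderivation} (r : RuleName) (Γ : Sequent) (E : Coderivation) :
      StepAt v D D' → StepAt (false :: v) (node2 r Γ D E) (node2 r Γ D' E)
  | in2r {v : Node} {E E' : Coderivation} (r : RuleName) (Γ : Sequent) (D : Coderivation) :
      StepAt v E E' → StepAt (true :: v) (node2 r Γ D E) (node2 r Γ D E')

/-- One step of cut elimination. -/
def Step (D E : Coderivation) : Prop := ∃ v, StepAt v D E

/-! ## Infinitary cut-elimination strategies -/

/-- Upper bound for the approximation order. -/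
def IsUB (S : Set Coderivation) (u : Coderivation) : Prop := ∀ x ∈ S, Approx x u

/-- Least upper bound for the approximation order. -/
def IsLubA (S : Set Coderivation) (u : Coderivation) : Prop :=
  IsUB S u ∧ ∀ w, IsUB S w → Approx u w

/-- Scott continuity with respect to the approximation order. -/
def ScottCont (f : Coderivation → Coderivation) : Prop :=
  (∀ D E, Approx D E → Approx (f D) (f E)) ∧
  ∀ S u, S.Nonempty → DirectedOn Approx S → IsLubA S u → IsLubA (f '' S) (f u)

/-- An infinitary cut-elimination strategy: for each open coderivation `D`, a
reduction sequence `σ_D` of length `len D ≤ ω`, starting at `D`, performing a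
cut-elimination step at each stage, and constant after `len D`. -/
structure Ices where
  seq : Coderivation → ℕ → Coderivation
  len : Coderivation → ℕ∞
  seq_zero : ∀ D, seq D 0 = D
  seq_step : ∀ D (i : ℕ), (i : ℕ∞) < len D → Step (seq D i) (seq D (i + 1))
  seq_stable : ∀ D (i : ℕ), len D ≤ (i : ℕ∞) → seq D (i + 1) = seq D i

/-- The function computed by an ices: the supremum of the greatest cut-free
approximations along the reduction sequence. -/
noncomputable def fIces (σ : Ices) (D : Coderivation) : Coderivation :=
  chainSup fun i => cf (σ.seq D i)

/-- Maximality: on (finite) open derivations the strategy reaches a normal form. -/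
def Ices.Maximal (σ : Ices) : Prop :=
  ∀ D, OPLLinf D → D.IsFinite → ∃ n : ℕ, σ.len D = (n : ℕ∞) ∧ Normal (σ.seq D n)

/-- Maximal and continuous infinitary cut-elimination strategy (mc-ices). -/
def Ices.IsMc (σ : Ices) : Prop := σ.Maximal ∧ ScottCont (fIces σ)

/-! ## The height-by-height strategy -/

/-- Code of a node: smaller codes mean smaller height, and for equal heights,
more to the left. -/
def nodeCode (v : Node) : ℕ := v.foldl (fun n b => 2 * n + cond b 1 0) 1

open Classical in
noncomputable def hbhNext (D : Coderivation) : Coderivation :=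
  if h : ∃ n, ∃ v E, StepAt v D E ∧ nodeCode v = n then
    (Nat.find_spec h).choose_spec.choose
  else D

/-- The height-by-height reduction sequence: at each stage, one cut-elimination
step is applied to the leftmost reducible cut of minimal height. -/
noncomputable def hbhSeq (D : Coderivation) : ℕ → Coderivation
  | 0 => D
  | n + 1 => hbhNext (hbhSeq D n)

/-- `f_{σ∞}`, the function computed by the height-by-height strategy. -/
noncomputable def fHbh (D : Coderivation) : Coderivation :=
  chainSup fun i => cf (hbhSeq D i)

/-! ## The Scott domain of open coderivations -/

/-- Open coderivations with conclusion `Γ`. -/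
def Dom (Γ : Sequent) : Set Coderivation := {D | OPLLinf D ∧ D.conclusion = Γ}

def IsLubOn (Γ : Sequent) (S : Set Coderivation) (u : Coderivation) : Prop :=
  u ∈ Dom Γ ∧ IsUB S u ∧ ∀ w ∈ Dom Γ, IsUB S w → Approx u w

/-- Compactness in the domain of open coderivations with conclusion `Γ`. -/
def CompactOn (Γ : Sequent) (x : Coderivation) : Prop :=
  ∀ S, S ⊆ Dom Γ → S.Nonempty → DirectedOn Approx S →
    ∀ u, IsLubOn Γ S u → Approx x u → ∃ y ∈ S, Approx x y

/-- Maximality in the domain of open coderivations with conclusion `Γ`. -/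
def MaxOn (Γ : Sequent) (x : Coderivation) : Prop :=
  ∀ y ∈ Dom Γ, Approx x y → x = y

/-! ## Relational semantics -/

/-- Codes for points of the relational model (`D_X := ℕ` for each variable):
`uStar` interprets units, `uEl` elements of the web of a variable, `uPair`
pairs, `uMSet` finite multisets. -/
def uStar : ℕ := Nat.pair 0 0
def uEl (n : ℕ) : ℕ := Nat.pair 1 n
def uPair (a b : ℕ) : ℕ := Nat.pair 2 (Nat.pair a b)
noncomputable def uMSet (m : Multiset ℕ) : ℕ := Nat.pair 3 (Encodable.encode m)

/-- The web of a formula. -/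
noncomputable def semF : Formula → Set ℕ
  | .var _ => Set.range uEl
  | .covar _ => Set.range uEl
  | .one => {uStar}
  | .bot => {uStar}
  | .tens A B => {x | ∃ a ∈ semF A, ∃ b ∈ semF B, x = uPair a b}
  | .parr A B => {x | ∃ a ∈ semF A, ∃ b ∈ semF B, x = uPair a b}
  | .bang A => {x | ∃ m : Multiset ℕ, (∀ a ∈ m, a ∈ semF A) ∧ x = uMSet m}
  | .quest A => {x | ∃ m : Multiset ℕ, (∀ a ∈ m, a ∈ semF A) ∧ x = uMSet m}

/-- Pointwise merge of a tuple of elements into a tuple of multisets. -/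
inductive MergeM : List ℕ → List ℕ → List ℕ → Prop where
  | nil : MergeM [] [] []
  | cons (x : ℕ) (m : Multiset ℕ) {xs ms ts : List ℕ} :
      MergeM xs ms ts → MergeM (x :: xs) (uMSet m :: ms) (uMSet (x ::ₘ m) :: ts)

/-- Transport of a tuple along a position alignment. -/
def AlignedTuple (f : ℕ → ℕ) (t t₀ : List ℕ) : Prop :=
  t.length = t₀.length ∧ ∀ i, i < t.length → t₀[f i]? = t[i]?

/-- The semantic clause of each rule, on canonical instances; `S b` is the
(already transported) interpretation of premise `b`. -/
noncomputable def CanonSem : RuleName → Sequent → (Bool → Set (List ℕ)) → Set (List ℕ)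
  | .ax, C₀, _ => {t | ∃ A x, C₀ = [A, A.neg] ∧ x ∈ semF A ∧ t = [x, x]}
  | .cut, _, S => {t | ∃ z u v, (z :: u) ∈ S false ∧ (z :: v) ∈ S true ∧ t = u ++ v}
  | .tens, _, S =>
      {t | ∃ a b u v, (a :: u) ∈ S false ∧ (b :: v) ∈ S true ∧ t = uPair a b :: (u ++ v)}
  | .parr, _, S => {t | ∃ a b u, (a :: b :: u) ∈ S false ∧ t = uPair a b :: u}
  | .one, _, _ => {[uStar]}
  | .bot, _, S => {t | ∃ u ∈ S false, t = uStar :: u}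
  | .qw, _, S => {t | ∃ u ∈ S false, t = uMSet 0 :: u}
  | .qb, _, S =>
      {t | ∃ y, ∃ μ : Multiset ℕ, ∃ u, (y :: uMSet μ :: u) ∈ S false ∧ t = uMSet (y ::ₘ μ) :: u}
  | .cp, C₀, S =>
      {t | t = List.replicate C₀.length (uMSet 0)} ∪
      {t | ∃ x xs m ms ts, (x :: xs) ∈ S false ∧ (uMSet m :: ms) ∈ S true ∧
        MergeM xs ms ts ∧ t = uMSet (x ::ₘ m) :: ts}
  | .dig, _, S =>
      {t | ∃ ms : List (Multiset ℕ), ∃ u,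
        (uMSet ((ms.map uMSet : List ℕ) : Multiset ℕ) :: u) ∈ S false ∧
        t = uMSet ms.sum :: u}
  | _, _, _ => ∅

/-- The `n`-th finite stage of the relational interpretation of a coderivation. -/
noncomputable def interpN : ℕ → Coderivation → Set (List ℕ)
  | 0, _ => ∅
  | n + 1, D =>
    {t | ∃ r C C₀ ps₀ f t₀,
      D.label [] = some (r, C) ∧ Canon r C₀ ps₀ ∧ PosAlign C C₀ f ∧
      AlignedTuple f t t₀ ∧
      t₀ ∈ CanonSem r C₀ (fun b =>
        {u₀ | ∃ P P₀ g u, D.seqAt [b] = some P ∧ ps₀[bIdx b]? = some P₀ ∧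
          PosAlign P P₀ g ∧ AlignedTuple g u u₀ ∧ u ∈ interpN n (D.subAt [b])})}

/-- The relational interpretation `⟦D⟧` of a coderivation. -/
noncomputable def interp (D : Coderivation) : Set (List ℕ) := ⋃ n, interpN n D

/-! ## Finite (wellfounded) derivations of `PLL` and `nuPLL`, and their translations -/

/-- Finite derivation trees (for `PLL`). -/
inductive PDeriv : Type where
  | p0 (r : RuleName) (Γ : Sequent) : PDeriv
  | p1 (r : RuleName) (Γ : Sequent) (D : PDeriv) : PDeriv
  | p2 (r : RuleName) (Γ : Sequent) (D E : PDeriv) : PDeriv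

def PDeriv.concl : PDeriv → Sequent
  | .p0 _ Γ => Γ
  | .p1 _ Γ _ => Γ
  | .p2 _ Γ _ _ => Γ

/-- Valid derivations of the sequent calculus `PLL`. -/
inductive PValid : PDeriv → Prop where
  | p0 (r : RuleName) (Γ : Sequent) :
      r ∈ pllRules → RuleOk r Γ [] → PValid (.p0 r Γ)
  | p1 (r : RuleName) (Γ : Sequent) (D : PDeriv) :
      r ∈ pllRules → RuleOk r Γ [D.concl] → PValid D → PValid (.p1 r Γ D)
  | p2 (r : RuleName) (Γ : Sequent) (D E : PDeriv) :
      r ∈ pllRules → RuleOk r Γ [D.concl, E.concl] → PValid D → PValid E →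
      PValid (.p2 r Γ D E)

/-- The translation `(·)° : PLL → PLL∞`, unfolding each functorial promotion
into a non-wellfounded box all of whose calls are equal. -/
def PDeriv.toCo : PDeriv → Coderivation
  | .p0 r Γ => node0 r Γ
  | .p1 r Γ D => if r = .fp then nwbOf Γ (fun _ => D.toCo) else node1 r Γ D.toCo
  | .p2 r Γ D E => node2 r Γ D.toCo E.toCo

/-- Wellfounded, infinitely-branching derivation trees (for `nuPLL`). -/
inductive NDeriv : Type where
  | n0 (r : RuleName) (Γ : Sequent) : NDeriv
  | n1 (r : RuleName) (Γ : Sequent) (D : NDeriv) : NDeriv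
  | n2 (r : RuleName) (Γ : Sequent) (D E : NDeriv) : NDeriv
  | nup (Γ : Sequent) (f : ℕ → NDeriv) : NDeriv

def NDeriv.concl : NDeriv → Sequent
  | .n0 _ Γ => Γ
  | .n1 _ Γ _ => Γ
  | .n2 _ Γ _ _ => Γ
  | .nup Γ _ => Γ

def nupllRules : Set RuleName := {.ax, .cut, .tens, .parr, .one, .bot, .qw, .qb}

/-- Valid derivations of `nuPLL`: the infinitely branching promotion `ν!p` has
countably many premises with the same conclusion, finitely many of which are
distinct. -/
inductive NValid : NDeriv → Prop where
  | n0 (r : RuleName) (Γ : Sequent) :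
      r ∈ nupllRules → RuleOk r Γ [] → NValid (.n0 r Γ)
  | n1 (r : RuleName) (Γ : Sequent) (D : NDeriv) :
      r ∈ nupllRules → RuleOk r Γ [D.concl] → NValid D → NValid (.n1 r Γ D)
  | n2 (r : RuleName) (Γ : Sequent) (D E : NDeriv) :
      r ∈ nupllRules → RuleOk r Γ [D.concl, E.concl] → NValid D → NValid E →
      NValid (.n2 r Γ D E)
  | nup (Γ : Sequent) (f : ℕ → NDeriv) :
      (∀ i, NValid (f i)) → (Set.range f).Finite →
      (∀ i, (f i).concl = (f 0).concl) →
      RuleOk .fp Γ [(f 0).concl] →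
      NValid (.nup Γ f)

/-- The translation `(·)• : nuPLL → PLL∞`, unfolding each `ν!p` with premises
`(D_i)` into the non-wellfounded box whose `i`-th call is `D_i•`. -/
def NDeriv.toCo : NDeriv → Coderivation
  | .n0 r Γ => node0 r Γ
  | .n1 r Γ D => node1 r Γ D.toCo
  | .n2 r Γ D E => node2 r Γ D.toCo E.toCo
  | .nup Γ f => nwbOf Γ (fun i => (f i).toCo)

/-! ## The digging counterexample -/

def fX : Formula := .var 0

/-- `N := !(X ⊸ X) ⊸ X ⊸ X = ?(X ⊗ X^⊥) ⅋ (X^⊥ ⅋ X)`. -/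
def fN : Formula := (Formula.quest (fX.tens fX.neg)).parr (fX.neg.parr fX)

/-- The derivation `0` of `⊢ N` (weakening over an axiom). -/
def cod0 : Coderivation :=
  node1 .parr [fN]
    (node1 .parr [.quest (fX.tens fX.neg), fX.neg.parr fX]
      (node1 .qw [.quest (fX.tens fX.neg), fX.neg, fX]
        (node0 .ax [fX.neg, fX])))

/-- The derivation `1` of `⊢ N` (absorption over a weakened tensor of axioms). -/
def cod1 : Coderivation :=
  node1 .parr [fN]
    (node1 .parr [.quest (fX.tens fX.neg), fX.neg.parr fX]
      (node1 .qb [.quest (fX.tens fX.neg), fX.neg, fX]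
        (node1 .qw [fX.tens fX.neg, .quest (fX.tens fX.neg), fX.neg, fX]
          (node2 .tens [fX.tens fX.neg, fX.neg, fX]
            (node0 .ax [fX, fX.neg])
            (node0 .ax [fX.neg, fX])))))

/-- The non-wellfounded box `⟨0,1,0,1,…⟩` of conclusion `⊢ !N`. -/
def boxAlt : Coderivation := nwbOf [fN.bang] fun i => if i % 2 = 0 then cod0 else cod1

/-- Digging applied to the axiom `⊢ ??N^⊥, !!N`. -/
def digCo : Coderivation :=
  node1 .dig [fN.neg.quest, fN.bang.bang]
    (node0 .ax [fN.neg.quest.quest, fN.bang.bang])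

/-- The coderivation `D_??d` of `⊢ !!N`. -/
def Ddig : Coderivation := node2 .cut [fN.bang.bang] boxAlt digCo

lemma brNode_succ (β : ℕ → Bool) (n : ℕ) : brNode β (n + 1) = brNode β n ++ [β n] := by
  simp [brNode, List.range_succ]

lemma brNode_succ_eq_cons (β : ℕ → Bool) (n : ℕ) :
    brNode β (n + 1) = β 0 :: brNode (fun i => β (i + 1)) n := by
  simp [brNode, List.range_succ_eq_map, Function.comp_def]

lemma length_brNode (β : ℕ → Bool) (n : ℕ) : (brNode β n).length = n := by
  simp [brNode]

lemma seqAt_nil (D : Coderivation) : D.seqAt [] = some D.conclusion := by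
  obtain ⟨x, hx⟩ := Option.isSome_iff_exists.1 D.root_isSome
  simp [Coderivation.seqAt, Coderivation.conclusion, hx]

/-- A property of nodes inherited by some child is inherited along an infinite branch. -/
lemma exists_branch_of_child {P : Node → Prop} {Q : Node → Bool → Prop} (h0 : P [])
    (h : ∀ v, P v → ∃ b, P (v ++ [b]) ∧ Q v b) :
    ∃ β : ℕ → Bool, ∀ n, P (brNode β n) ∧ Q (brNode β n) (β n) := by
  choose! b hb using h
  let s : ℕ → Node := fun n => n.rec [] fun _ v => v ++ [b v]
  have hs : ∀ n, brNode (fun n => b (s n)) n = s n := by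
    intro n
    induction n with
    | zero => rfl
    | succ n ih => rw [brNode_succ, ih]
  have hP : ∀ n, P (s n) := by
    intro n
    induction n with
    | zero => exact h0
    | succ n ih => exact (hb _ ih).1
  refine ⟨fun n => b (s n), fun n => ?_⟩
  rw [hs]
  exact ⟨hP n, (hb _ (hP n)).2⟩

/-- Inductive provability in `PLL`. -/
inductive Provable : Sequent → Prop where
  | rule {r : RuleName} {Γ : Sequent} {ps : List Sequent} :
      r ∈ pllRules → RuleOk r Γ ps → (∀ p ∈ ps, Provable p) → Provable Γ

/-- A node labelled by a sequent which is not provable in `PLL`. -/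
def IsUnprovable (D : Coderivation) (v : Node) : Prop :=
  ∃ r Γ, D.label v = some (r, Γ) ∧ ¬ Provable Γ

lemma isUnprovable_of_seqAt {D : Coderivation} {v : Node} {p : Sequent}
    (h : D.seqAt v = some p) (hp : ¬ Provable p) : IsUnprovable D v := by
  simp only [Coderivation.seqAt, Option.map_eq_some_iff] at h
  obtain ⟨⟨r, Γ⟩, h1, rfl⟩ := h
  exact ⟨r, Γ, h1, hp⟩

lemma exists_seqAt_of_mem_premsAt {D : Coderivation} {v : Node} {p : Sequent}
    (h : p ∈ D.premsAt v) : ∃ b, D.seqAt (v ++ [b]) = some p := by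
  simp only [Coderivation.premsAt, List.mem_append, Option.mem_toList] at h
  exact h.elim (fun h => ⟨_, h⟩) fun h => ⟨_, h⟩

lemma seqAt_of_premsAt_eq_cons {D : Coderivation} {v : Node} {p : Sequent} {ps : List Sequent}
    (h : D.premsAt v = p :: ps) : D.seqAt (v ++ [false]) = some p := by
  have ho := D.ordered v
  cases h1 : D.label (v ++ [false]) <;> cases h2 : D.label (v ++ [true]) <;>
    simp_all [Coderivation.premsAt, Coderivation.seqAt]

lemma isUnprovable_child {D : Coderivation} {v : Node} {r : RuleName} {Γ : Sequent}
    (hr : r ∈ pllRules) (hok : RuleOk r Γ (D.premsAt v)) (hΓ : ¬ Provable Γ) :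
    ∃ b, IsUnprovable D (v ++ [b]) := by
  by_contra! hc
  refine hΓ (.rule hr hok fun p hp => ?_)
  by_contra hpn
  obtain ⟨b, hb⟩ := exists_seqAt_of_mem_premsAt hp
  exact hc b (isUnprovable_of_seqAt hb hpn)

lemma IsPLLDer.provable {D : Coderivation} (hD : IsPLLDer D) : Provable D.conclusion := by
  by_contra hc
  obtain ⟨β, hβ⟩ := exists_branch_of_child (P := IsUnprovable D) (Q := fun _ _ => True)
    (isUnprovable_of_seqAt (seqAt_nil D) hc) (by
      rintro v ⟨r, Γ, hl, hΓ⟩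
      obtain ⟨hr, hok⟩ := hD.1 v r Γ hl
      obtain ⟨b, hb⟩ := isUnprovable_child hr hok hΓ
      exact ⟨b, hb, trivial⟩)
  refine Set.infinite_of_injective_forall_mem (f := brNode β) (fun m n hmn => ?_) (fun n => ?_) hD.2
  · simpa [length_brNode] using congrArg List.length hmn
  · obtain ⟨r, Γ, hl, -⟩ := (hβ n).1
    simp [Coderivation.mem, hl]

lemma WeaklyProg.provable {D : Coderivation} (hw : WeaklyProg D) (hD : PLLinf D) :
    Provable D.conclusion := by
  by_contra hc
  obtain ⟨β, hβ⟩ := exists_branch_of_child (P := IsUnprovable D)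
    (Q := fun v b => ¬ (b = true ∧ D.ruleAt v = some .cp))
    (isUnprovable_of_seqAt (seqAt_nil D) hc) (by
      rintro v ⟨r, Γ, hl, hΓ⟩
      obtain ⟨hr, hok⟩ := hD v r Γ hl
      by_cases hcp : r = .cp
      · subst hcp
        refine ⟨false, ?_, by simp⟩
        obtain ⟨C₀, ps₀, hC, hperm, hps⟩ := hok
        cases hC with
        | cp A Δ =>
          generalize hps' : D.premsAt v = ps at hps
          cases hps with
          | cons h1 _ =>
            refine isUnprovable_of_seqAt (seqAt_of_premsAt_eq_cons hps') fun hp => hΓ ?_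
            refine .rule (r := .fp) (by simp [pllRules]) ⟨_, _, .fp A Δ, hperm, .cons h1 .nil⟩ ?_
            simpa using hp
      · have hr' : r ∈ pllRules := by
          revert hr; cases r <;> simp_all [pllRules, pllInfRules]
        obtain ⟨b, hb⟩ := isUnprovable_child hr' hok hΓ
        exact ⟨b, hb, by simp [Coderivation.ruleAt, hl, hcp]⟩)
  obtain ⟨n, -, hn⟩ := hw β (fun n => by
    obtain ⟨r, Γ, hl, -⟩ := (hβ n).1
    simp [Coderivation.mem, hl]) 0
  exact (hβ n).2 hn

section Constructors

variable {S : Set RuleName} {r : RuleName} {Γ : Sequent} {D E : Coderivation}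

lemma isOver_node0 (hr : r ∈ S) (hok : RuleOk r Γ []) : (node0 r Γ).IsOver S := by
  rintro (_ | ⟨b, v⟩) r' Γ' h
  · cases h
    exact ⟨hr, hok⟩
  · cases h

lemma isOver_node1 (hr : r ∈ S) (hok : RuleOk r Γ [D.conclusion]) (hD : D.IsOver S) :
    (node1 r Γ D).IsOver S := by
  rintro (_ | ⟨_ | _, v⟩) r' Γ' h
  · cases h
    have : (node1 r Γ D).premsAt [] = (D.seqAt []).toList ++ [] := rfl
    rw [this, seqAt_nil]
    exact ⟨hr, hok⟩
  · exact hD v r' Γ' h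
  · cases h

lemma isOver_node2 (hr : r ∈ S) (hok : RuleOk r Γ [D.conclusion, E.conclusion])
    (hD : D.IsOver S) (hE : E.IsOver S) : (node2 r Γ D E).IsOver S := by
  rintro (_ | ⟨_ | _, v⟩) r' Γ' h
  · cases h
    have : (node2 r Γ D E).premsAt [] = (D.seqAt []).toList ++ (E.seqAt []).toList := rfl
    rw [this, seqAt_nil, seqAt_nil]
    exact ⟨hr, hok⟩
  · exact hD v r' Γ' h
  · exact hE v r' Γ' h

lemma isOver_nwbOf_const (hr : .cp ∈ S) (hok : RuleOk .cp Γ [D.conclusion, Γ])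
    (hD : D.IsOver S) : (nwbOf Γ fun _ => D).IsOver S := by
  intro v
  induction v with
  | nil =>
    intro r' Γ' h
    cases h
    have : (nwbOf Γ fun _ => D).premsAt [] = (D.seqAt []).toList ++ [Γ] := rfl
    rw [this, seqAt_nil]
    exact ⟨hr, hok⟩
  | cons b v ih =>
    cases b with
    | false => exact hD v
    | true => exact ih

lemma isFinite_node0 : (node0 r Γ).IsFinite := by
  refine (Set.finite_singleton ([] : Node)).subset ?_
  rintro (_ | ⟨b, v⟩) h
  · rfl
  · cases h

lemma isFinite_node1 (hD : D.IsFinite) : (node1 r Γ D).IsFinite := by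
  refine ((hD.image (List.cons false)).insert []).subset ?_
  rintro (_ | ⟨_ | _, v⟩) h
  · exact Or.inl rfl
  · exact Or.inr ⟨v, h, rfl⟩
  · cases h

lemma isFinite_node2 (hD : D.IsFinite) (hE : E.IsFinite) : (node2 r Γ D E).IsFinite := by
  refine (((hD.image (List.cons false)).union (hE.image (List.cons true))).insert []).subset ?_
  rintro (_ | ⟨_ | _, v⟩) h
  · exact Or.inl rfl
  · exact Or.inr (Or.inl ⟨v, h, rfl⟩)
  · exact Or.inr (Or.inr ⟨v, h, rfl⟩)

/-- The branch `β` takes the right premise of a `c!p` rule infinitely often. -/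
def IsProgBranch (D : Coderivation) (β : ℕ → Bool) : Prop :=
  ∀ N, ∃ n, N ≤ n ∧ β n = true ∧ D.ruleAt (brNode β n) = some .cp

lemma isProgBranch_of_tail {β : ℕ → Bool} (hl : ∀ w, D.label (β 0 :: w) = E.label w)
    (hE : InfBranch E (fun i => β (i + 1)) → IsProgBranch E (fun i => β (i + 1)))
    (hβ : InfBranch D β) : IsProgBranch D β := by
  intro N
  have hb : InfBranch E (fun i => β (i + 1)) := fun n => by
    have := hβ (n + 1)
    rwa [brNode_succ_eq_cons, Coderivation.mem, hl] at this
  obtain ⟨n, hn, h1, h2⟩ := hE hb N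
  refine ⟨n + 1, by omega, h1, ?_⟩
  rwa [brNode_succ_eq_cons, Coderivation.ruleAt, hl]

lemma weaklyProg_node0 : WeaklyProg (node0 r Γ) := by
  intro β hβ
  cases hβ 1

lemma weaklyProg_node1 (hD : WeaklyProg D) : WeaklyProg (node1 r Γ D) := by
  intro β hβ
  cases h : β 0 with
  | false => exact isProgBranch_of_tail (E := D) (fun w => by rw [h]; rfl) (hD _) hβ
  | true =>
    have := hβ 1
    rw [brNode_succ_eq_cons, h] at this
    cases this

lemma weaklyProg_node2 (hD : WeaklyProg D) (hE : WeaklyProg E) :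
    WeaklyProg (node2 r Γ D E) := by
  intro β hβ
  cases h : β 0 with
  | false => exact isProgBranch_of_tail (E := D) (fun w => by rw [h]; rfl) (hD _) hβ
  | true => exact isProgBranch_of_tail (E := E) (fun w => by rw [h]; rfl) (hE _) hβ

lemma weaklyProg_nwbOf_const (hD : WeaklyProg D) : WeaklyProg (nwbOf Γ fun _ => D) := by
  have key : ∀ k, ∀ β : ℕ → Bool, β k = false → InfBranch (nwbOf Γ fun _ => D) β →
      IsProgBranch (nwbOf Γ fun _ => D) β := by
    intro k
    induction k with
    | zero =>
      intro β h hβ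
      exact isProgBranch_of_tail (E := D) (fun w => by rw [h]; rfl) (hD _) hβ
    | succ k ih =>
      intro β hk hβ
      cases h : β 0 with
      | false => exact isProgBranch_of_tail (E := D) (fun w => by rw [h]; rfl) (hD _) hβ
      | true =>
        exact isProgBranch_of_tail (E := nwbOf Γ fun _ => D) (fun w => by rw [h]; rfl)
          (ih _ hk) hβ
  intro β hβ
  by_cases hf : ∃ k, β k = false
  · obtain ⟨k, hk⟩ := hf
    exact key k β hk hβ
  · obtain rfl : β = fun _ => true := by
      funext k
      simpa using fun h => hf ⟨k, h⟩
    refine fun N => ⟨N, le_rfl, rfl, ?_⟩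
    clear hf hβ
    induction N with
    | zero => rfl
    | succ n ih =>
      rw [brNode_succ_eq_cons]
      exact ih

end Constructors

lemma length_le_two_of_ruleOk {r : RuleName} {Γ : Sequent} {ps : List Sequent}
    (h : RuleOk r Γ ps) : ps.length ≤ 2 := by
  obtain ⟨C₀, ps₀, hC, -, hps⟩ := h
  rw [hps.length_eq]
  cases hC <;> simp

lemma Provable.exists_isPLLDer {Γ : Sequent} (h : Provable Γ) :
    ∃ D : Coderivation, IsPLLDer D ∧ D.conclusion = Γ := by
  induction h with
  | @rule r Γ ps hr hok _ ih =>
    match ps with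
    | [] => exact ⟨node0 r Γ, ⟨isOver_node0 hr hok, isFinite_node0⟩, rfl⟩
    | [p] =>
      obtain ⟨D, ⟨hD, hF⟩, rfl⟩ := ih p (by simp)
      exact ⟨node1 r Γ D, ⟨isOver_node1 hr hok hD, isFinite_node1 hF⟩, rfl⟩
    | [p, q] =>
      obtain ⟨D, ⟨hD, hF⟩, rfl⟩ := ih p (by simp)
      obtain ⟨E, ⟨hE, hG⟩, rfl⟩ := ih q (by simp)
      exact ⟨node2 r Γ D E, ⟨isOver_node2 hr hok hD hE, isFinite_node2 hF hG⟩, rfl⟩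
    | _ :: _ :: _ :: _ => simpa using length_le_two_of_ruleOk hok

lemma Provable.exists_weaklyProg {Γ : Sequent} (h : Provable Γ) :
    ∃ D : Coderivation, PLLinf D ∧ WeaklyProg D ∧ D.conclusion = Γ := by
  induction h with
  | @rule r Γ ps hr hok _ ih =>
    by_cases hfp : r = .fp
    · subst hfp
      obtain ⟨C₀, ps₀, hC, hperm, hps⟩ := hok
      cases hC with
      | fp A Δ =>
        obtain ⟨p, _, hp, hnil, rfl⟩ := List.forall₂_cons_right_iff.1 hps
        cases hnil
        obtain ⟨D, hD, hw, rfl⟩ := ih p (by simp)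
        exact ⟨nwbOf Γ fun _ => D,
          isOver_nwbOf_const (by simp [pllInfRules])
            ⟨_, _, .cp A Δ, hperm, .cons hp (.cons hperm .nil)⟩ hD,
          weaklyProg_nwbOf_const hw, rfl⟩
    · have hr' : r ∈ pllInfRules := by
        revert hr; cases r <;> simp_all [pllRules, pllInfRules]
      match ps with
      | [] => exact ⟨node0 r Γ, isOver_node0 hr' hok, weaklyProg_node0, rfl⟩
      | [p] =>
        obtain ⟨D, hD, hw, rfl⟩ := ih p (by simp)
        exact ⟨node1 r Γ D, isOver_node1 hr' hok hD, weaklyProg_node1 hw, rfl⟩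
      | [p, q] =>
        obtain ⟨D, hD, hw, rfl⟩ := ih p (by simp)
        obtain ⟨E, hE, hw', rfl⟩ := ih q (by simp)
        exact ⟨node2 r Γ D E, isOver_node2 hr' hok hD hE, weaklyProg_node2 hw hw', rfl⟩
      | _ :: _ :: _ :: _ => simpa using length_le_two_of_ruleOk hok

/-- **Lemma 4.9**: a sequent is provable in `PLL` iff it is provable in
`wpPLL∞`, the weakly progressing coderivations of `PLL∞`. -/
theorem pll_provable_iff_wppll (Γ : Sequent) :
    (∃ D : Coderivation, IsPLLDer D ∧ D.conclusion = Γ) ↔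
      (∃ D : Coderivation, PLLinf D ∧ WeaklyProg D ∧ D.conclusion = Γ) := by
  constructor
  · rintro ⟨D, hD, rfl⟩
    exact hD.provable.exists_weaklyProg
  · rintro ⟨D, hD, hw, rfl⟩
    exact (hw.provable hD).exists_isPLLDer

end NWPLL
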